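/- The set of odd squarefree integers N ≥ 3 satisfying ψ(N) ≤ 2^{ω(N)} · 348 is finite, has exactly 471 elements, and its largest element is 3003. -/

import Mathlib

open Finset

/-- The Dedekind psi function `ψ(N) = N ∏_{p ∣ N} (1 + 1/p)`, as a real number. -/
noncomputable def dedekindPsi (N : ℕ) : ℝ :=
  N * ∏ p ∈ N.primeFactors, (1 + 1 / (p : ℝ))

/-- Value when `n` is one or prime. -/
def psiB (n A : ℕ) : Bool := Nat.ble (A * (if n = 1 then 1 else (n + 1) / 2)) 348

/-- Trial-division test for odd `n` all of whose prime factors are at least `d`. -/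
def psiGo : ℕ → ℕ → ℕ → ℕ → Bool
  | 0, _, n, A => psiB n A
  | f + 1, d, n, A =>
    if n < d * d then psiB n A
    else if n % d = 0 then
      (if (n / d) % d = 0 then false else psiGo f (d + 2) (n / d) (A * ((d + 1) / 2)))
    else psiGo f (d + 2) n A

lemma psiGo_base (d n A : ℕ) (hn : 0 < n) (hp : ∀ p, p.Prime → p ∣ n → d ≤ p)
    (h : n < d * d) :
    psiB n A = true ↔
      Squarefree n ∧ A * ∏ p ∈ n.primeFactors, (p + 1) / 2 ≤ 348 := by
  rw [psiB, Nat.ble_eq]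
  by_cases h1 : n = 1
  · subst h1; simp
  · have hpr : n.Prime := by
      by_contra hc
      have h2 := Nat.minFac_sq_le_self hn hc
      have h3 := hp _ (Nat.minFac_prime h1) (Nat.minFac_dvd n)
      nlinarith
    simp [h1, hpr.primeFactors, hpr.prime.irreducible.squarefree]

lemma psiGo_spec (f : ℕ) : ∀ d n A : ℕ, 0 < n → n % 2 = 1 → d % 2 = 1 → 3 ≤ d →
    (∀ p, p.Prime → p ∣ n → d ≤ p) → n < (d + 2 * f) * (d + 2 * f) →
    (psiGo f d n A = true ↔
      Squarefree n ∧ A * ∏ p ∈ n.primeFactors, (p + 1) / 2 ≤ 348) := by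
  induction f with
  | zero =>
    intro d n A hn _ _ _ hp h
    exact psiGo_base d n A hn hp (by simpa using h)
  | succ f ih =>
    intro d n A hn ho hdo hd hp h
    rw [psiGo]
    split_ifs with h1 h2 h3
    · exact psiGo_base d n A hn hp h1
    · obtain ⟨m, rfl⟩ := Nat.dvd_of_mod_eq_zero h2
      rw [Nat.mul_div_cancel_left m (by omega)] at h3
      obtain ⟨k, rfl⟩ := Nat.dvd_of_mod_eq_zero h3
      simp only [Bool.false_eq_true, false_iff, not_and]
      intro hs
      have := hs d ⟨k, by ring⟩
      rw [Nat.isUnit_iff] at this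
      omega
    · obtain ⟨m, rfl⟩ := Nat.dvd_of_mod_eq_zero h2
      rw [Nat.mul_div_cancel_left m (by omega)] at h3 ⊢
      have hdp : d.Prime := by
        have h4 := hp _ (Nat.minFac_prime (by omega : d ≠ 1))
          ((Nat.minFac_dvd d).trans (dvd_mul_right d m))
        have h5 := Nat.minFac_le (by omega : 0 < d)
        have h6 : d.minFac = d := by omega
        rw [← h6]; exact Nat.minFac_prime (by omega)
      have hm : 0 < m := Nat.pos_of_mul_pos_left hn
      have hmo : m % 2 = 1 := by
        have := (Nat.odd_mul.1 (Nat.odd_iff.2 ho)).2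
        exact Nat.odd_iff.1 this
      have hdm : ¬ d ∣ m := fun hh => h3 (Nat.mod_eq_zero_of_dvd hh)
      have hco : Nat.Coprime d m := (Nat.Prime.coprime_iff_not_dvd hdp).2 hdm
      rw [ih (d + 2) m _ hm hmo (by omega) (by omega) ?_ ?_]
      · rw [Nat.squarefree_mul hco, hco.primeFactors_mul, hdp.primeFactors,
          Finset.prod_union, Finset.prod_singleton, mul_assoc]
        · simp [hdp.prime.irreducible.squarefree]
        · simp [hdm]
      · intro p hpp hpm
        have h7 := hp p hpp (hpm.mul_left d)
        have h8 : p ≠ d := by rintro rfl; exact hdm hpm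
        have h9 : p % 2 = 1 := by rcases hpp.eq_two_or_odd with h | h <;> omega
        omega
      · have : m ≤ d * m := Nat.le_mul_of_pos_left m (by omega)
        have e : d + 2 + 2 * f = d + 2 * (f + 1) := by ring
        rw [e]; omega
    · rw [ih (d + 2) n _ hn ho (by omega) (by omega) ?_ ?_]
      · intro p hpp hpm
        have h7 := hp p hpp hpm
        have h8 : p ≠ d := by rintro rfl; exact h2 (Nat.mod_eq_zero_of_dvd hpm)
        have h9 : p % 2 = 1 := by rcases hpp.eq_two_or_odd with h | h <;> omega
        omega
      · have e : d + 2 + 2 * f = d + 2 * (f + 1) := by ring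
        rw [e]; exact h

lemma odd_prime_of_mem {N p : ℕ} (ho : Odd N) (hp : p ∈ N.primeFactors) :
    p.Prime ∧ p % 2 = 1 ∧ 3 ≤ p := by
  have h1 := Nat.prime_of_mem_primeFactors hp
  have h2 := Nat.odd_iff.1 (ho.of_dvd_nat (Nat.dvd_of_mem_primeFactors hp))
  have := h1.two_le
  exact ⟨h1, h2, by omega⟩

lemma dedekindPsi_eq {N : ℕ} (ho : Odd N) (hs : Squarefree N) :
    dedekindPsi N = 2 ^ N.primeFactors.card * ((∏ p ∈ N.primeFactors, (p + 1) / 2 : ℕ) : ℝ) := by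
  have h : (N : ℝ) = ∏ p ∈ N.primeFactors, (p : ℝ) := by
    conv_lhs => rw [← Nat.prod_primeFactors_of_squarefree hs]
    push_cast; rfl
  unfold dedekindPsi
  conv_lhs => rw [h]
  rw [← Finset.prod_const, Nat.cast_prod, ← Finset.prod_mul_distrib, ← Finset.prod_mul_distrib]
  refine Finset.prod_congr rfl fun p hp => ?_
  obtain ⟨h1, h2, h3⟩ := odd_prime_of_mem ho hp
  obtain ⟨k, rfl⟩ : ∃ k, p = 2 * k + 1 := ⟨p / 2, by omega⟩
  have e : (2 * k + 1 + 1) / 2 = k + 1 := by omega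
  rw [e]
  have : ((2 * k + 1 : ℕ) : ℝ) ≠ 0 := by positivity
  field_simp
  push_cast; ring

lemma psi_iff {N : ℕ} (ho : Odd N) (hs : Squarefree N) :
    dedekindPsi N ≤ 2 ^ N.primeFactors.card * 348 ↔
      ∏ p ∈ N.primeFactors, (p + 1) / 2 ≤ 348 := by
  rw [dedekindPsi_eq ho hs, mul_le_mul_iff_right₀ (by positivity)]
  exact_mod_cast Iff.rfl

/-- Correction factors. -/
def psiC (p : ℕ) : ℚ :=
  if p = 3 then 27 / 16 else if p = 5 then 125 / 81 else if p = 7 then 343 / 256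
  else if p = 11 then 1331 / 1296 else 1

lemma one_le_psiC (p : ℕ) : 1 ≤ psiC p := by
  unfold psiC; split_ifs <;> norm_num

lemma psi_bound {N : ℕ} (ho : Odd N) (hs : Squarefree N)
    (h : ∏ p ∈ N.primeFactors, (p + 1) / 2 ≤ 348) : N < 3800 := by
  have h1 : ∏ p ∈ N.primeFactors, (p : ℚ) ^ 3 ≤
      ∏ p ∈ N.primeFactors, (psiC p * (((p + 1) / 2 : ℕ) : ℚ) ^ 4) := by
    refine Finset.prod_le_prod (fun _ _ => by positivity) fun p hp => ?_
    obtain ⟨h1, h2, h3⟩ := odd_prime_of_mem ho hp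
    by_cases h13 : p < 13
    · interval_cases p <;> first | omega | (norm_num [psiC]; done) | (exfalso; revert h1; norm_num)
    · obtain ⟨k, rfl⟩ : ∃ k, p = 2 * k + 1 := ⟨p / 2, by omega⟩
      have e : (2 * k + 1 + 1) / 2 = k + 1 := by omega
      have hc : psiC (2 * k + 1) = 1 := by
        unfold psiC
        rw [if_neg (by omega), if_neg (by omega), if_neg (by omega), if_neg (by omega)]
      rw [e, hc]
      obtain ⟨j, rfl⟩ : ∃ j, k = j + 6 := ⟨k - 6, by omega⟩
      push_cast
      have hj : (0 : ℚ) ≤ j := by positivity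
      have : (0:ℚ) ≤ 1 * ((j:ℚ) + 6 + 1) ^ 4 - (2 * ((j:ℚ) + 6) + 1) ^ 3 := by
        ring_nf; positivity
      linarith
  rw [Finset.prod_mul_distrib, Finset.prod_pow, Finset.prod_pow, ← Nat.cast_prod,
    ← Nat.cast_prod, Nat.prod_primeFactors_of_squarefree hs] at h1
  have h2 : ∏ p ∈ N.primeFactors, psiC p ≤ ∏ p ∈ ({3, 5, 7, 11} : Finset ℕ), psiC p := by
    calc _ ≤ ∏ p ∈ N.primeFactors ∪ {3, 5, 7, 11}, psiC p :=
by
          rw [← Finset.prod_sdiff (Finset.subset_union_left (s₁ := N.primeFactors)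
            (s₂ := {3, 5, 7, 11}))]
          refine le_mul_of_one_le_left
            (Finset.prod_nonneg fun i _ => zero_le_one.trans (one_le_psiC i)) ?_
          exact Finset.one_le_prod fun i _ => one_le_psiC i
      _ = _ := by
          symm
          refine Finset.prod_subset Finset.subset_union_right fun p _ hp => ?_
          simp only [Finset.mem_insert, Finset.mem_singleton, not_or] at hp
          simp [psiC, hp]
  have h3 : ∏ p ∈ ({3, 5, 7, 11} : Finset ℕ), psiC p
      = 27 / 16 * (125 / 81) * (343 / 256) * (1331 / 1296) := by
    norm_num [psiC]
  have h4 : ((∏ p ∈ N.primeFactors, (p + 1) / 2 : ℕ) : ℚ) ≤ 348 := by exact_mod_cast h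
  have h5 : ((∏ p ∈ N.primeFactors, (p + 1) / 2 : ℕ) : ℚ) ^ 4 ≤ 348 ^ 4 := by gcongr
  have h6 : (N : ℚ) ^ 3 < 3800 ^ 3 := by
    calc (N : ℚ) ^ 3 ≤ _ := h1
      _ ≤ (27 / 16 * (125 / 81) * (343 / 256) * (1331 / 1296)) * 348 ^ 4 := by
        rw [← h3]
        refine mul_le_mul h2 h5 (by positivity) ?_
        rw [h3]; norm_num
      _ < _ := by norm_num
  have := lt_of_pow_lt_pow_left₀ 3 (by norm_num) h6
  exact_mod_cast this

/-- The solutions, as a computable finset. -/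
def psiSol : Finset ℕ :=
  (Finset.range 3800).filter fun N => (Nat.ble 3 N && (N % 2 == 1) && psiGo 30 3 N 1) = true

lemma psi_set_eq : {N : ℕ | 3 ≤ N ∧ Odd N ∧ Squarefree N ∧
    dedekindPsi N ≤ 2 ^ (N.primeFactors.card) * 348} = (psiSol : Set ℕ) := by
  ext N
  simp only [Set.mem_ofPred_eq, psiSol, Finset.coe_filter, Finset.mem_range, Bool.and_eq_true,
    Nat.ble_eq, beq_iff_eq]
  have key : N < 3800 → 3 ≤ N → N % 2 = 1 → (psiGo 30 3 N 1 = true ↔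
      Squarefree N ∧ 1 * ∏ p ∈ N.primeFactors, (p + 1) / 2 ≤ 348) := by
    intro h1 h2 h3
    refine psiGo_spec 30 3 N 1 (by omega) h3 (by norm_num) le_rfl ?_ (by omega)
    intro p hp hd
    exact (odd_prime_of_mem (Nat.odd_iff.2 h3)
      (Nat.mem_primeFactors.2 ⟨hp, hd, by omega⟩)).2.2
  constructor
  · rintro ⟨h1, h2, h3, h4⟩
    rw [psi_iff h2 h3] at h4
    have h5 := psi_bound h2 h3 h4
    exact ⟨h5, ⟨h1, Nat.odd_iff.1 h2⟩,
      (key h5 h1 (Nat.odd_iff.1 h2)).2 ⟨h3, by simpa using h4⟩⟩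
  · rintro ⟨h1, ⟨h2, h3⟩, h4⟩
    have h5 := (key h1 h2 h3).1 h4
    have ho := Nat.odd_iff.2 h3
    exact ⟨h2, ho, h5.1, (psi_iff ho h5.1).2 (by simpa using h5.2)⟩

set_option maxRecDepth 100000 in
lemma psiSol_card : psiSol.card = 471 := by decide +kernel

set_option maxRecDepth 100000 in
lemma psiSol_max : 3003 ∈ psiSol ∧ ∀ N ∈ psiSol, N ≤ 3003 := by decide +kernel

/-- The set of odd squarefree integers `N ≥ 3` with `ψ(N) ≤ 2^{ω(N)} · 348` is finite,
has exactly `471` elements, and its largest element is `3003`. -/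
theorem odd_squarefree_psi_bounded :
    {N : ℕ | 3 ≤ N ∧ Odd N ∧ Squarefree N ∧
        dedekindPsi N ≤ 2 ^ (N.primeFactors.card) * 348}.Finite ∧
    {N : ℕ | 3 ≤ N ∧ Odd N ∧ Squarefree N ∧
        dedekindPsi N ≤ 2 ^ (N.primeFactors.card) * 348}.ncard = 471 ∧
    IsGreatest {N : ℕ | 3 ≤ N ∧ Odd N ∧ Squarefree N ∧
        dedekindPsi N ≤ 2 ^ (N.primeFactors.card) * 348} 3003 := by
  rw [psi_set_eq]
  refine ⟨psiSol.finite_toSet, ?_, ?_, ?_⟩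
  · rw [Set.ncard_coe_finset]; exact psiSol_card
  · exact Finset.mem_coe.2 psiSol_max.1
  · intro N hN; exact psiSol_max.2 N (Finset.mem_coe.1 hN)
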